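/- Fix 0 < p ≤ 1/2, a rate R = k/n ∈ (0,1), α with 0 < α ≤ 1/2 and H(α) < (1−R)·log₂(1/(1−p)), and θ > −log₂((1−p)^{−(1−R)} − 1). Then there exist constants c > 0 and D such that for every d₀ ≥ D, the probability, over the ensemble TZ_p, that the Toeplitz code (H_τ)_{τ≥1} satisfies minW(d) ≥ αnd and numW(w,d) ≤ 2^{θw} for every d ≥ d₀ and every w ≥ αnd, is at least 1 − 2^{−c·n·d₀}. -/

import Mathlib

/-!
STATEMENT 1: Abundance of anytime-reliable time-invariant (Toeplitz) codes. Fix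
`0 < p ≤ 1/2`, `R = k/n ∈ (0,1)`, `α ∈ (0,1/2]` with `H(α) < (1−R)log₂(1/(1−p))`, and
`θ > −log₂((1−p)^{−(1−R)} − 1)`. Then there are `c > 0` and `D` such that for every
`d₀ ≥ D`, with probability at least `1 − 2^{−cnd₀}` over `TZ_p`, the code satisfies
`minW(d) ≥ αnd` and `numW(w,d) ≤ 2^{θw}` for all `d ≥ d₀` and all `w ≥ αnd`.

The probability over the infinite product measure (entries of `H₂, H₃, …` i.i.d.
Bernoulli(p)) is rendered via its finite-dimensional marginals: since the good events
are decreasing in the horizon `Dm` and depend only on `H₂, …, H_{Dm}`, the infinite-product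
probability of `{∀ d ≥ d₀ : good(d)}` is `≥ 1 − 2^{−cnd₀}` **iff** for every horizon `Dm`
the (finite, elementary) probability of `{∀ d, d₀ ≤ d ≤ Dm : good(d)}` is `≥ 1 − 2^{−cnd₀}`.
The statement below quantifies over all `Dm`, which is exactly equivalent.
-/

open scoped BigOperators

/-- Binary entropy function in bits (with `H(0) = H(1) = 0`, since `Real.logb 2 0 = 0`). -/
noncomputable def binH (x : ℝ) : ℝ := -(x * Real.logb 2 x) - (1 - x) * Real.logb 2 (1 - x)

/-- The `n̄d × nd` block lower-triangular Toeplitz matrix `𝐇_d` whose `(i,j)`-th block is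
`H (i−j+1)` for `i ≥ j` and `0` otherwise (blocks are indexed from `0`, so the block
sequence used is `H 1, H 2, …, H d`). -/
def toep (nb n : ℕ) (H : ℕ → Matrix (Fin nb) (Fin n) (ZMod 2)) (d : ℕ) :
    Matrix (Fin d × Fin nb) (Fin d × Fin n) (ZMod 2) :=
  fun p q => if (q.1 : ℕ) ≤ (p.1 : ℕ) then H ((p.1 : ℕ) - (q.1 : ℕ) + 1) p.2 q.2 else 0

/-- A block vector `(c₁, …, c_d) ∈ (F₂ⁿ)^d` flattened into a vector indexed by `Fin d × Fin n`. -/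
def flat {d n : ℕ} (c : Fin d → Fin n → ZMod 2) : Fin d × Fin n → ZMod 2 :=
  fun q => c q.1 q.2

/-- Hamming weight `‖c‖` of a block vector. -/
def wt {d n : ℕ} (c : Fin d → Fin n → ZMod 2) : ℕ := hammingNorm (flat c)

/-- `C_d = {c ∈ (F₂ⁿ)^d : 𝐇_d c = 0 and c₁ ≠ 0}`. -/
def Cset (nb n : ℕ) (H : ℕ → Matrix (Fin nb) (Fin n) (ZMod 2)) (d : ℕ) (hd : 0 < d) :
    Finset (Fin d → Fin n → ZMod 2) :=
  Finset.univ.filter fun c =>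
    Matrix.mulVec (toep nb n H d) (flat c) = 0 ∧ c ⟨0, hd⟩ ≠ 0

/-- `numW(w,d) = #{c ∈ C_d : ‖c‖ = w}`. -/
def numW (nb n : ℕ) (H : ℕ → Matrix (Fin nb) (Fin n) (ZMod 2)) (d : ℕ) (hd : 0 < d)
    (w : ℕ) : ℕ :=
  ((Cset nb n H d hd).filter fun c => wt c = w).card

/-- Bernoulli(p) weight of a binary matrix: each entry is `1` w.p. `p`, `0` w.p. `1−p`. -/
noncomputable def matWt (p : ℝ) {nb n : ℕ} (M : Matrix (Fin nb) (Fin n) (ZMod 2)) : ℝ :=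
  ∏ a : Fin nb, ∏ b : Fin n, if M a b = 1 then p else 1 - p

/-- The i.i.d. product weight of a finite tuple of binary matrices. -/
noncomputable def tupWt (p : ℝ) {ι : Type} [Fintype ι] {nb n : ℕ}
    (ω : ι → Matrix (Fin nb) (Fin n) (ZMod 2)) : ℝ := ∏ i, matWt p (ω i)

/-- The random block sequence in the ensemble `TZ_p`: block `1` is the fixed matrix `H1`,
blocks `τ ≥ 2` are random (given by the sample point `ω`; the slots `ω 0, ω 1` are
unused, so summing their Bernoulli weights out leaves the probability unchanged). -/
def seq {nb n : ℕ} (H1 : Matrix (Fin nb) (Fin n) (ZMod 2)) {D : ℕ}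
    (ω : Fin (D + 1) → Matrix (Fin nb) (Fin n) (ZMod 2)) :
    ℕ → Matrix (Fin nb) (Fin n) (ZMod 2) :=
  fun τ => if τ = 1 then H1 else if h2 : τ < D + 1 then ω ⟨τ, h2⟩ else 0

open scoped Classical in
/-- Probability, over the blocks `H₂, …, H_{D}` having i.i.d. Bernoulli(p) entries,
of an event `S` (a sum of i.i.d. product weights over the finite sample space). -/
noncomputable def prOmega (p : ℝ) {nb n : ℕ} (D : ℕ)
    (S : (Fin (D + 1) → Matrix (Fin nb) (Fin n) (ZMod 2)) → Prop) : ℝ :=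
  ∑ ω : Fin (D + 1) → Matrix (Fin nb) (Fin n) (ZMod 2), if S ω then tupWt p ω else 0

/-- Extension of a finite tuple to a sequence. -/
def extz {M : Type} [Zero M] {m : ℕ} (ω : Fin m → M) : ℕ → M :=
  fun i => if h : i < m then ω ⟨i, h⟩ else 0

lemma chain_bound {M : Type} [Zero M] [Fintype M] (μ : M → ℝ) (hμ : ∀ x, 0 ≤ μ x)
    (f : ℕ → M → (ℕ → M) → ℝ) (hf : ∀ i x h, 0 ≤ f i x h) (a : ℕ → ℝ) (ha : ∀ i, 0 ≤ a i)
    (hdep : ∀ i x h h', (∀ j < i, h j = h' j) → f i x h = f i x h')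
    (hb : ∀ i h, ∑ x, μ x * f i x h ≤ a i) (m : ℕ) :
    ∑ ω : Fin m → M, (∏ i, μ (ω i)) * ∏ i : Fin m, f i (ω i) (extz ω) ≤ ∏ i : Fin m, a i := by
  induction m with
  | zero => simp
  | succ m ih =>
    rw [← (Fin.snocEquiv (fun _ : Fin (m+1) => M)).sum_comp, Fintype.sum_prod_type_right]
    rw [Fin.prod_univ_castSucc]
    have key : ∀ (y : Fin m → M) (x : M),
        (∏ i, μ ((Fin.snocEquiv (fun _ : Fin (m+1) => M)) (x, y) i)) *
          ∏ i : Fin (m+1), f i ((Fin.snocEquiv (fun _ : Fin (m+1) => M)) (x, y) i)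
            (extz ((Fin.snocEquiv (fun _ : Fin (m+1) => M)) (x, y))) =
        ((∏ i, μ (y i)) * ∏ i : Fin m, f i (y i) (extz y)) * (μ x * f m x (extz y)) := by
      intro y x
      have e : ∀ j < m, extz ((Fin.snocEquiv (fun _ : Fin (m+1) => M)) (x, y)) j = extz y j := by
        intro j hj
        simp only [extz, hj, Nat.lt_succ_of_lt hj, dif_pos, Fin.snocEquiv_apply]
        exact Fin.snoc_castSucc (α := fun _ => M) x y ⟨j, hj⟩
      rw [Fin.prod_univ_castSucc, Fin.prod_univ_castSucc]
      have e2 : ∀ i : Fin m, f i (y i) (extz ((Fin.snocEquiv (fun _ : Fin (m+1) => M)) (x, y)))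
          = f i (y i) (extz y) := fun i => hdep _ _ _ _ fun j hj => e j (by omega)
      have e3 : f m x (extz ((Fin.snocEquiv (fun _ : Fin (m+1) => M)) (x, y)))
          = f m x (extz y) := hdep _ _ _ _ fun j hj => e j hj
      simp only [Fin.snocEquiv_apply, Fin.snoc_castSucc, Fin.snoc_last, Fin.val_castSucc,
        Fin.val_last] at e2 e3 ⊢
      simp only [e2, e3]
      ring
    simp only [key, ← Finset.mul_sum]
    calc _ ≤ ∑ y : Fin m → M, ((∏ i, μ (y i)) * ∏ i : Fin m, f i (y i) (extz y)) * a m := by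
          apply Finset.sum_le_sum
          intro y _
          apply mul_le_mul_of_nonneg_left (hb _ _)
          exact mul_nonneg (Finset.prod_nonneg fun _ _ => hμ _) (Finset.prod_nonneg fun _ _ => hf _ _ _)
      _ ≤ _ := by
          rw [← Finset.sum_mul]
          exact mul_le_mul_of_nonneg_right ih (ha _)

lemma sum_prod_pi {ι κ : Type} [Fintype ι] [DecidableEq ι] [Fintype κ] (g : ι → κ → ℝ) :
    ∑ x : ι → κ, ∏ i, g i (x i) = ∏ i, ∑ y, g i y := by
  rw [Finset.prod_univ_sum]; simp

lemma sum_z2 (g : ZMod 2 → ℝ) : ∑ y, g y = g 0 + g 1 := Fin.sum_univ_two g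

lemma z2_cases (x : ZMod 2) : x = 0 ∨ x = 1 := by
  fin_cases x
  · exact Or.inl rfl
  · exact Or.inr rfl

lemma chi_sum {ι : Type} (s : Finset ι) (g : ι → ZMod 2) :
    (if ∑ i ∈ s, g i = 0 then (1:ℝ) else -1) = ∏ i ∈ s, (if g i = 0 then (1:ℝ) else -1) := by
  classical
  induction s using Finset.induction_on with
  | empty => simp
  | insert a s ha ih =>
    rw [Finset.sum_insert ha, Finset.prod_insert ha, ← ih]
    generalize g a = x
    generalize (∑ i ∈ s, g i) = y
    rcases z2_cases x with rfl | rfl <;> rcases z2_cases y with rfl | rfl <;>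
      simp [show (1:ZMod 2) + 1 = 0 from rfl]

lemma row_bound {n : ℕ} (p : ℝ) (hp0 : 0 < p) (hp : p ≤ 1/2) (v : Fin n → ZMod 2) (hv : v ≠ 0)
    (u : ZMod 2) :
    ∑ r : Fin n → ZMod 2, (∏ b, if r b = 1 then p else 1 - p) *
      (if ∑ b, r b * v b = u then (1:ℝ) else 0) ≤ 1 - p := by
  have ind : ∀ x : ZMod 2, (if x = u then (1:ℝ) else 0) =
      (1 + (if x = 0 then (1:ℝ) else -1) * (if u = 0 then (1:ℝ) else -1)) / 2 := by
    intro x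
    rcases z2_cases x with rfl | rfl <;> rcases z2_cases u with rfl | rfl <;> norm_num
  have h1 : ∑ r : Fin n → ZMod 2, (∏ b, if r b = 1 then p else 1 - p) = 1 := by
    rw [sum_prod_pi (fun _ y => if y = 1 then p else 1 - p)]
    simp [sum_z2]
  have h2 : ∑ r : Fin n → ZMod 2, (∏ b, if r b = 1 then p else 1 - p) *
      (if ∑ b, r b * v b = 0 then (1:ℝ) else -1) = ∏ b, (if v b = 0 then 1 else 1 - 2 * p) := by
    simp only [chi_sum, ← Finset.prod_mul_distrib]
    rw [sum_prod_pi (fun b y => (if y = 1 then p else 1 - p) * (if y * v b = 0 then (1:ℝ) else -1))]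
    apply Finset.prod_congr rfl
    intro b _
    rw [sum_z2]
    by_cases h : v b = 0 <;> simp [h]
    ring
  obtain ⟨j, hj⟩ : ∃ j, v j ≠ 0 := by
    by_contra hcon
    push Not at hcon
    exact hv (funext hcon)
  have h0 : ∀ b, 0 ≤ (if v b = 0 then (1:ℝ) else 1 - 2 * p) := by
    intro b; split_ifs <;> linarith
  have h3 : ∏ b, (if v b = 0 then (1:ℝ) else 1 - 2 * p) ≤ 1 - 2 * p := by
    rw [← Finset.mul_prod_erase _ _ (Finset.mem_univ j), if_neg hj]
    refine mul_le_of_le_one_right (by linarith) (Finset.prod_le_one (fun b _ => h0 b) ?_)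
    intro b _; split_ifs <;> linarith
  have h3' := Finset.prod_nonneg (s := Finset.univ) (fun b _ => h0 b)
  have h4 : ∑ r : Fin n → ZMod 2, (∏ b, if r b = 1 then p else 1 - p) *
      (if ∑ b, r b * v b = u then (1:ℝ) else 0) =
      (1 + (∏ b, (if v b = 0 then (1:ℝ) else 1 - 2 * p)) * (if u = 0 then (1:ℝ) else -1)) / 2 := by
    rw [← h2]
    trans ((∑ r : Fin n → ZMod 2, (∏ b, if r b = 1 then p else 1 - p)) + (∑ r : Fin n → ZMod 2,
      (∏ b, if r b = 1 then p else 1 - p) * (if ∑ b, r b * v b = 0 then (1:ℝ) else -1)) *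
        (if u = 0 then (1:ℝ) else -1)) / 2
    swap
    · rw [h1]
    rw [Finset.sum_mul, ← Finset.sum_add_distrib, Finset.sum_div]
    apply Finset.sum_congr rfl
    intro r _
    rw [ind]
    ring
  rw [h4]
  split_ifs <;> linarith

lemma mat_bound {nb n : ℕ} (p : ℝ) (hp0 : 0 < p) (hp : p ≤ 1/2) (v : Fin n → ZMod 2) (hv : v ≠ 0)
    (u : Fin nb → ZMod 2) :
    ∑ M : Matrix (Fin nb) (Fin n) (ZMod 2), matWt p M *
      (if M.mulVec v = u then (1:ℝ) else 0) ≤ (1 - p) ^ nb := by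
  have h : ∀ M : Matrix (Fin nb) (Fin n) (ZMod 2), matWt p M *
      (if M.mulVec v = u then (1:ℝ) else 0) =
      ∏ a, ((∏ b, if M a b = 1 then p else 1 - p) *
        (if ∑ b, M a b * v b = u a then (1:ℝ) else 0)) := by
    intro M
    rw [Finset.prod_mul_distrib, matWt]
    congr 1
    rw [Finset.prod_boole]
    simp [funext_iff, Matrix.mulVec, dotProduct]
  simp only [h]
  refine (sum_prod_pi (ι := Fin nb) (κ := Fin n → ZMod 2) (fun a r => (∏ b, if r b = 1 then p else 1 - p) *
        (if ∑ b, r b * v b = u a then (1:ℝ) else 0))).le.trans ?_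
  refine (Finset.prod_le_prod (fun a _ => ?_) (fun a _ => row_bound p hp0 hp v hv (u a))).trans ?_
  · apply Finset.sum_nonneg
    intro r _
    apply mul_nonneg
    · apply Finset.prod_nonneg
      intro b _; split_ifs <;> linarith
    · split_ifs <;> norm_num
  · simp

lemma matWt_nonneg {nb n : ℕ} (p : ℝ) (hp0 : 0 < p) (hp : p ≤ 1/2)
    (M : Matrix (Fin nb) (Fin n) (ZMod 2)) : 0 ≤ matWt p M := by
  refine Finset.prod_nonneg fun a _ => Finset.prod_nonneg fun b _ => ?_
  split_ifs <;> linarith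

lemma matWt_sum {nb n : ℕ} (p : ℝ) :
    ∑ M : Matrix (Fin nb) (Fin n) (ZMod 2), matWt p M = 1 := by
  refine (sum_prod_pi (ι := Fin nb) (κ := Fin n → ZMod 2)
    (fun a r => ∏ b, if r b = 1 then p else 1 - p)).trans ?_
  apply Finset.prod_eq_one
  intro a _
  rw [sum_prod_pi (fun _ y => if y = 1 then p else 1 - p)]
  simp [sum_z2]

lemma tupWt_nonneg {nb n D : ℕ} (p : ℝ) (hp0 : 0 < p) (hp : p ≤ 1/2)
    (ω : Fin D → Matrix (Fin nb) (Fin n) (ZMod 2)) : 0 ≤ tupWt p ω :=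
  Finset.prod_nonneg fun _ _ => matWt_nonneg p hp0 hp _

lemma tupWt_sum {nb n D : ℕ} (p : ℝ) :
    ∑ ω : Fin D → Matrix (Fin nb) (Fin n) (ZMod 2), tupWt p ω = 1 := by
  simp only [tupWt]
  rw [sum_prod_pi (fun _ M => matWt p M)]
  simp [matWt_sum]

lemma code_bound {nb n : ℕ} (p : ℝ) (hp0 : 0 < p) (hp : p ≤ 1/2)
    (H1 : Matrix (Fin nb) (Fin n) (ZMod 2)) (D d : ℕ) (hd : 0 < d) (hdD : d ≤ D)
    (c : Fin d → Fin n → ZMod 2) :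
    ∑ ω : Fin (D+1) → Matrix (Fin nb) (Fin n) (ZMod 2),
      tupWt p ω * (if c ∈ Cset nb n (seq H1 ω) d hd then (1:ℝ) else 0) ≤ ((1 - p)^nb)^(d-1) := by
  obtain ⟨d, rfl⟩ : ∃ e, d = e + 1 := ⟨d - 1, by omega⟩
  have hq0 : 0 ≤ (1 - p)^nb := by apply pow_nonneg; linarith
  by_cases hv : c 0 = 0
  · have : ∀ H, c ∉ Cset nb n H (d+1) hd := by
      intro H hc
      simp only [Cset, Finset.mem_filter] at hc
      exact hc.2.2 hv
    simp only [this, if_false, mul_zero, Finset.sum_const_zero]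
    exact pow_nonneg hq0 _
  let G : ℕ → (ℕ → Matrix (Fin nb) (Fin n) (ZMod 2)) → (Fin nb → ZMod 2) := fun i h a =>
    - ∑ j : Fin d, ∑ b : Fin n, if (j:ℕ) + 1 ≤ i - 1 then
      (if i - 1 - (j + 1) + 1 = 1 then H1 else h (i - 1 - (j + 1) + 1)) a b * c j.succ b else 0
  let f : ℕ → Matrix (Fin nb) (Fin n) (ZMod 2) → (ℕ → Matrix (Fin nb) (Fin n) (ZMod 2)) → ℝ :=
    fun i x h => if 2 ≤ i ∧ i ≤ d + 1 then (if x.mulVec (c 0) = G i h then 1 else 0) else 1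
  let a : ℕ → ℝ := fun i => if 2 ≤ i ∧ i ≤ d + 1 then (1-p)^nb else 1
  have hG : ∀ i h h', (∀ j < i, h j = h' j) → G i h = G i h' := by
    intro i h h' hh
    funext a
    simp only [G]
    congr 1
    refine Finset.sum_congr rfl fun j _ => Finset.sum_congr rfl fun b _ => ?_
    split_ifs with h1 h2
    · rfl
    · rw [hh _ (by omega)]
    · rfl
  have hf : ∀ i x h, 0 ≤ f i x h := by
    intro i x h
    simp only [f]; split_ifs <;> norm_num
  have main := chain_bound (matWt p (nb := nb) (n := n)) (matWt_nonneg p hp0 hp) f hf a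
    (by intro i; simp only [a]; split_ifs <;> [exact hq0; norm_num])
    (by intro i x h h' hh; simp only [f, hG i h h' hh])
    (by
      intro i h
      simp only [f, a]
      by_cases hi : 2 ≤ i ∧ i ≤ d + 1
      · simp only [hi, and_self, if_true]
        exact mat_bound p hp0 hp _ hv _
      · simp only [if_neg hi, mul_one]
        exact (matWt_sum p).le) (D+1)
  have ha : ∏ i : Fin (D+1), a i = ((1 - p)^nb)^(d+1-1) := by
    rw [Fin.prod_univ_eq_prod_range a]
    simp only [a]
    rw [Finset.prod_ite, Finset.prod_const_one, mul_one, Finset.prod_const]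
    congr 1
    have : (Finset.range (D+1)).filter (fun x => 2 ≤ x ∧ x ≤ d + 1) = Finset.Icc 2 (d+1) := by
      ext x; simp only [Finset.mem_filter, Finset.mem_range, Finset.mem_Icc]; omega
    rw [this]; simp
  rw [ha] at main
  refine le_trans (Finset.sum_le_sum fun ω _ => ?_) main
  apply mul_le_mul_of_nonneg_left _ (tupWt_nonneg p hp0 hp ω)
  split_ifs with hc
  swap
  · exact Finset.prod_nonneg fun _ _ => hf _ _ _
  apply le_of_eq
  symm
  apply Finset.prod_eq_one
  intro i _
  simp only [f]
  split_ifs with h1 h2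
  · rfl
  · exfalso
    apply h2
    simp only [Cset, Finset.mem_filter] at hc
    have hz := hc.2.1
    funext a
    have hz' := congrFun hz (⟨(i:ℕ) - 1, by omega⟩, a)
    simp only [Matrix.mulVec, dotProduct, Fintype.sum_prod_type, Fin.sum_univ_succ, toep, flat,
      Pi.zero_apply] at hz'
    simp only [G, Matrix.mulVec, dotProduct]
    rw [← add_eq_zero_iff_eq_neg]
    refine Eq.trans ?_ hz'
    congr 1
    · refine Finset.sum_congr rfl fun b _ => ?_
      have e1 : (i:ℕ) - 1 - ((0 : Fin (d+1)) : ℕ) + 1 = i := by simp; omega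
      have e2 : (i:ℕ) ≠ 1 := by omega
      rw [if_pos (by simp), e1]
      simp only [seq, if_neg e2, i.2, dif_pos]
    · refine Finset.sum_congr rfl fun j _ => Finset.sum_congr rfl fun b _ => ?_
      simp only [Fin.val_succ]
      by_cases h3 : (j:ℕ) + 1 ≤ i - 1
      · rw [if_pos h3, if_pos h3]
        simp only [seq, extz]
      · rw [if_neg h3, if_neg h3, zero_mul]
  · rfl

lemma wt_sum (d n : ℕ) (s : ℝ) :
    ∑ c : Fin d → Fin n → ZMod 2, s ^ wt c = ((1 + s)^n)^d := by
  have : ∀ c : Fin d → Fin n → ZMod 2, s ^ wt c = ∏ i, ∏ b, if c i b ≠ 0 then s else 1 := by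
    intro c
    rw [← Fintype.prod_prod_type' (f := fun i b => if c i b ≠ 0 then s else 1), Finset.prod_ite]
    simp only [wt, hammingNorm, flat, Finset.prod_const, one_pow, mul_one]
    congr!
  simp only [this]
  rw [sum_prod_pi (fun i (r : Fin n → ZMod 2) => ∏ b, if r b ≠ 0 then s else 1)]
  have h : ∑ r : Fin n → ZMod 2, (∏ b, if r b ≠ 0 then s else (1:ℝ)) = (1+s)^n := by
    rw [sum_prod_pi (fun b y => if y ≠ 0 then s else (1:ℝ))]
    simp [sum_z2]
  simp only [h]
  simp

lemma exp_bound {nb n : ℕ} (p : ℝ) (hp0 : 0 < p) (hp : p ≤ 1/2)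
    (H1 : Matrix (Fin nb) (Fin n) (ZMod 2)) (D d : ℕ) (hd : 0 < d) (hdD : d ≤ D)
    (s : ℝ) (hs : 0 < s) :
    ∑ ω : Fin (D+1) → Matrix (Fin nb) (Fin n) (ZMod 2),
      tupWt p ω * ∑ c ∈ Cset nb n (seq H1 ω) d hd, s ^ wt c ≤
      ((1-p)^nb)⁻¹ * ((1 + s)^n * (1 - p)^nb)^d := by
  have e : ∀ ω : Fin (D+1) → Matrix (Fin nb) (Fin n) (ZMod 2),
      tupWt p ω * ∑ c ∈ Cset nb n (seq H1 ω) d hd, s ^ wt c =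
      ∑ c : Fin d → Fin n → ZMod 2, s ^ wt c *
        (tupWt p ω * (if c ∈ Cset nb n (seq H1 ω) d hd then (1:ℝ) else 0)) := by
    intro ω
    have h2 : ∀ c : Fin d → Fin n → ZMod 2, s ^ wt c *
        (tupWt p ω * (if c ∈ Cset nb n (seq H1 ω) d hd then (1:ℝ) else 0)) =
        if c ∈ Cset nb n (seq H1 ω) d hd then tupWt p ω * s ^ wt c else 0 := by
      intro c; split_ifs <;> ring
    simp only [h2]
    rw [Finset.sum_ite_mem, Finset.univ_inter, Finset.mul_sum]
  simp only [e]
  rw [Finset.sum_comm]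
  simp only [← Finset.mul_sum]
  calc _ ≤ ∑ c : Fin d → Fin n → ZMod 2, s ^ wt c * ((1 - p)^nb)^(d-1) :=
        Finset.sum_le_sum fun c _ => mul_le_mul_of_nonneg_left
          (code_bound p hp0 hp H1 D d hd hdD c) (by positivity)
    _ = _ := by
        rw [← Finset.sum_mul, wt_sum]
        have hq : (1-p)^nb ≠ 0 := pow_ne_zero _ (by linarith)
        obtain ⟨d, rfl⟩ : ∃ e, d = e + 1 := ⟨d - 1, by omega⟩
        rw [mul_pow, Nat.add_sub_cancel, pow_succ ((1-p)^nb)]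
        field_simp

lemma numeric (n : ℕ) (hn : 0 < n) (K x y : ℝ) (hK : 0 < K) (hx0 : 0 < x) (hx : x < 1)
    (hy0 : 0 < y) (hy : y < 1) :
    ∃ c : ℝ, 0 < c ∧ ∃ D : ℕ, 0 < D ∧ ∀ d₀ : ℕ, D ≤ d₀ → ∀ Dm : ℕ,
      ∑ d ∈ Finset.Icc d₀ Dm, (K * x ^ d + K * y ^ d) ≤ (2:ℝ) ^ (-(c * n * d₀)) := by
  set z := max x y with hz
  have hz0 : 0 < z := lt_max_of_lt_left hx0
  have hz1 : z < 1 := max_lt hx hy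
  set r := Real.sqrt z with hr
  have hr0 : 0 < r := Real.sqrt_pos.mpr hz0
  have hrr : r * r = z := Real.mul_self_sqrt hz0.le
  have hr1 : r < 1 := by nlinarith
  have hn' : (0:ℝ) < n := by exact_mod_cast hn
  have hlim := tendsto_pow_atTop_nhds_zero_of_lt_one hr0.le hr1
  have hC : 0 < (1 - z) / (2 * K) := by
    apply div_pos <;> linarith
  obtain ⟨D, hD⟩ := Filter.eventually_atTop.mp (hlim.eventually (gt_mem_nhds hC))
  refine ⟨-Real.logb 2 r / n, div_pos (neg_pos.mpr (Real.logb_neg (by norm_num) hr0 hr1)) hn',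
    D + 1, by omega, ?_⟩
  intro d₀ hd Dm
  have e : (2:ℝ) ^ (-(-Real.logb 2 r / n * n * d₀)) = r ^ d₀ := by
    rw [div_mul_cancel₀ _ hn'.ne', neg_mul, neg_neg, Real.rpow_mul (by norm_num),
      Real.rpow_logb (by norm_num) (by norm_num) hr0, Real.rpow_natCast]
  rw [e]
  have h1 : ∑ d ∈ Finset.Icc d₀ Dm, (K * x ^ d + K * y ^ d) ≤
      ∑ d ∈ Finset.Ico d₀ (Dm + 1), 2 * K * z ^ d := by
    have : Finset.Icc d₀ Dm = Finset.Ico d₀ (Dm + 1) := by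
      ext; simp only [Finset.mem_Icc, Finset.mem_Ico]; omega
    rw [this]
    apply Finset.sum_le_sum
    intro d _
    have a1 : x ^ d ≤ z ^ d := pow_le_pow_left₀ hx0.le (le_max_left _ _) _
    have a2 : y ^ d ≤ z ^ d := pow_le_pow_left₀ hy0.le (le_max_right _ _) _
    nlinarith
  refine h1.trans ?_
  rw [← Finset.mul_sum]
  have h2 : ∑ d ∈ Finset.Ico d₀ (Dm + 1), z ^ d ≤ z ^ d₀ / (1 - z) :=
    geom_sum_Ico_le_of_lt_one hz0.le hz1
  have h3 := hD d₀ (by omega)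
  have h4 : z ^ d₀ = r ^ d₀ * r ^ d₀ := by rw [← hrr, mul_pow]
  have h5 : 0 < r ^ d₀ := pow_pos hr0 _
  rw [lt_div_iff₀ (by linarith)] at h3
  calc 2 * K * ∑ d ∈ Finset.Ico d₀ (Dm + 1), z ^ d ≤ 2 * K * (z ^ d₀ / (1 - z)) :=
        mul_le_mul_of_nonneg_left h2 (by linarith)
    _ ≤ r ^ d₀ := by
        rw [← mul_div_assoc, div_le_iff₀ (by linarith), h4]
        nlinarith

lemma x_lt (k n : ℕ) (hkn : k < n) (p α : ℝ) (hp0 : 0 < p) (hp : p ≤ 1 / 2)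
    (hα0 : 0 < α) (hα : α ≤ 1 / 2)
    (hαH : binH α < (1 - (k : ℝ) / n) * Real.logb 2 (1 / (1 - p))) :
    ((α / (1 - α)) ^ (-α)) ^ n * ((1 + α / (1 - α)) ^ n * (1 - p) ^ (n - k)) < 1 := by
  have h1 : 0 < 1 - α := by linarith
  have h2 : 0 < 1 - p := by linarith
  have hn : (0:ℝ) < n := by exact_mod_cast (by omega : 0 < n)
  have ht : 0 < α / (1 - α) := div_pos hα0 h1
  have e : 1 + α / (1 - α) = 1 / (1 - α) := by field_simp; ring
  have hA : 0 < ((α / (1 - α)) ^ (-α)) := Real.rpow_pos_of_pos ht _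
  rw [e]
  rw [← Real.logb_neg_iff (b := 2) (by norm_num) (by positivity)]
  rw [Real.logb_mul (by positivity) (by positivity), Real.logb_mul (by positivity) (by positivity),
    Real.logb_pow, Real.logb_pow, Real.logb_pow, Real.logb_rpow_eq_mul_logb_of_pos ht,
    Real.logb_div hα0.ne' h1.ne', one_div, Real.logb_inv, Nat.cast_sub hkn.le]
  rw [binH, one_div, Real.logb_inv] at hαH
  have := mul_lt_mul_of_pos_left hαH hn
  have e2 : (n:ℝ) * ((1 - (k : ℝ) / n) * -Real.logb 2 (1 - p)) =
    -((n - k) * Real.logb 2 (1 - p)) := by field_simp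
  rw [e2] at this
  nlinarith

lemma y_lt (k n : ℕ) (hkn : k < n) (hk : 0 < k) (p θ : ℝ) (hp0 : 0 < p) (hp : p ≤ 1 / 2)
    (hθ : -Real.logb 2 ((1 - p) ^ (-(1 - (k : ℝ) / n)) - 1) < θ) :
    (1 + (2:ℝ) ^ (-θ)) ^ n * (1 - p) ^ (n - k) < 1 := by
  have h2 : 0 < 1 - p := by linarith
  have hn : (0:ℝ) < n := by exact_mod_cast (by omega : 0 < n)
  have hR : (k:ℝ) / n < 1 := by rw [div_lt_one hn]; exact_mod_cast hkn
  have hB : 1 < (1 - p) ^ (-(1 - (k : ℝ) / n)) :=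
    Real.one_lt_rpow_of_pos_of_lt_one_of_neg h2 (by linarith) (by linarith)
  have h3 : (2:ℝ) ^ (-θ) < (1 - p) ^ (-(1 - (k : ℝ) / n)) - 1 := by
    rw [← Real.lt_logb_iff_rpow_lt (by norm_num) (by linarith)]
    linarith
  have h4 : (1 + (2:ℝ) ^ (-θ)) ^ n < ((1 - p) ^ (-(1 - (k : ℝ) / n))) ^ n := by
    apply pow_lt_pow_left₀ (by linarith) (by positivity) (by omega)
  have h5 : ((1 - p) ^ (-(1 - (k : ℝ) / n))) ^ n = ((1 - p) ^ (n - k))⁻¹ := by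
    rw [← Real.rpow_natCast, ← Real.rpow_mul h2.le, ← Real.rpow_natCast, ← Real.rpow_neg h2.le,
      Nat.cast_sub hkn.le]
    congr 1
    field_simp
  rw [h5] at h4
  have h6 : 0 < (1 - p) ^ (n - k) := pow_pos h2 _
  calc _ < ((1 - p) ^ (n - k))⁻¹ * (1 - p) ^ (n - k) := mul_lt_mul_of_pos_right h4 h6
    _ = 1 := inv_mul_cancel₀ h6.ne'

lemma pr_lower {nb n : ℕ} (p : ℝ) (hp0 : 0 < p) (hp : p ≤ 1 / 2) (D : ℕ)
    (S : (Fin (D + 1) → Matrix (Fin nb) (Fin n) (ZMod 2)) → Prop)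
    (B : (Fin (D + 1) → Matrix (Fin nb) (Fin n) (ZMod 2)) → ℝ) (hB0 : ∀ ω, 0 ≤ B ω)
    (hB : ∀ ω, ¬ S ω → 1 ≤ B ω) :
    1 - ∑ ω, tupWt p ω * B ω ≤ prOmega p D S := by
  classical
  rw [prOmega, sub_le_iff_le_add, ← tupWt_sum (nb := nb) (n := n) (D := D+1) p,
    ← Finset.sum_add_distrib]
  apply Finset.sum_le_sum
  intro ω _
  have := tupWt_nonneg p hp0 hp ω
  by_cases h : S ω
  · rw [if_pos h]; have := mul_nonneg this (hB0 ω); linarith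
  · rw [if_neg h]; have := mul_le_mul_of_nonneg_left (hB ω h) this; linarith

theorem abundance_of_time_invariant_codes
    (k n : ℕ) (hk : 0 < k) (hkn : k < n)
    (p α θ : ℝ) (hp0 : 0 < p) (hp : p ≤ 1 / 2)
    (hα0 : 0 < α) (hα : α ≤ 1 / 2)
    (hαH : binH α < (1 - (k : ℝ) / n) * Real.logb 2 (1 / (1 - p)))
    (hθ : -Real.logb 2 ((1 - p) ^ (-(1 - (k : ℝ) / n)) - 1) < θ)
    (H1 : Matrix (Fin (n - k)) (Fin n) (ZMod 2))
    (hH1 : LinearIndependent (ZMod 2) H1) :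
    ∃ c : ℝ, 0 < c ∧ ∃ D : ℕ, ∀ d₀ : ℕ, D ≤ d₀ → ∀ Dm : ℕ,
      1 - 2 ^ (-(c * n * d₀)) ≤
        prOmega p Dm (fun ω =>
          ∀ (d : ℕ) (hd : 0 < d), d₀ ≤ d → d ≤ Dm →
            (∀ cw ∈ Cset (n - k) n (seq H1 ω) d hd, α * n * d ≤ (wt cw : ℝ)) ∧
            (∀ w : ℕ, α * n * d ≤ (w : ℝ) →
              (numW (n - k) n (seq H1 ω) d hd w : ℝ) ≤ 2 ^ (θ * w))) := by
  have hn : 0 < n := by omega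
  have h1α : 0 < 1 - α := by linarith
  have h1p : 0 < 1 - p := by linarith
  set t := α / (1 - α) with ht
  have ht0 : 0 < t := div_pos hα0 h1α
  have ht1 : t ≤ 1 := by rw [ht, div_le_one h1α]; linarith
  set s := (2:ℝ) ^ (-θ) with hs
  have hs0 : 0 < s := by positivity
  set A := (t ^ (-α)) ^ n with hA
  have hA0 : 0 < A := pow_pos (Real.rpow_pos_of_pos ht0 _) _
  have hx := x_lt k n hkn p α hp0 hp hα0 hα hαH
  have hy := y_lt k n hkn hk p θ hp0 hp hθ
  have hq0 : 0 < (1 - p) ^ (n - k) := pow_pos h1p _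
  obtain ⟨c, hc, D, hD0, hD⟩ := numeric n hn ((1 - p) ^ (n - k))⁻¹ _ _ (by positivity)
    (by positivity) hx (by positivity) hy
  refine ⟨c, hc, D, fun d₀ hd₀ Dm => ?_⟩
  have hD' := hD d₀ hd₀ Dm
  let F : (Fin (Dm + 1) → Matrix (Fin (n - k)) (Fin n) (ZMod 2)) → ℕ → ℝ := fun ω d =>
    if hd : 0 < d then A ^ d * ∑ c ∈ Cset (n - k) n (seq H1 ω) d hd, t ^ wt c +
      ∑ c ∈ Cset (n - k) n (seq H1 ω) d hd, s ^ wt c else 0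
  have hF0 : ∀ ω d, 0 ≤ F ω d := by
    intro ω d
    simp only [F]
    split_ifs
    · positivity
    · exact le_rfl
  refine le_trans ?_ (pr_lower p hp0 hp Dm _ (fun ω => ∑ d ∈ Finset.Icc d₀ Dm, F ω d)
    (fun ω => Finset.sum_nonneg fun d _ => hF0 ω d) ?_)
  · apply sub_le_sub_left
    refine le_trans ?_ hD'
    simp only [Finset.mul_sum]
    rw [Finset.sum_comm]
    apply Finset.sum_le_sum
    intro d hd
    rw [Finset.mem_Icc] at hd
    have hd0 : 0 < d := by omega
    have b1 := exp_bound p hp0 hp H1 Dm d hd0 hd.2 t ht0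
    have b2 := exp_bound p hp0 hp H1 Dm d hd0 hd.2 s hs0
    simp only [F, dif_pos hd0, mul_add, Finset.sum_add_distrib]
    refine add_le_add ?_ b2
    have e : ∀ ω : Fin (Dm + 1) → Matrix (Fin (n - k)) (Fin n) (ZMod 2),
        tupWt p ω * (A ^ d * ∑ c ∈ Cset (n - k) n (seq H1 ω) d hd0, t ^ wt c) =
        A ^ d * (tupWt p ω * ∑ c ∈ Cset (n - k) n (seq H1 ω) d hd0, t ^ wt c) := fun ω => by ring
    simp only [e]
    rw [← Finset.mul_sum]
    refine (mul_le_mul_of_nonneg_left b1 (by positivity)).trans (le_of_eq ?_)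
    rw [mul_pow A]
    ring
  · intro ω hbad
    by_contra hlt
    rw [not_le] at hlt
    apply hbad
    intro d hd h1 h2
    have hFd : F ω d < 1 := lt_of_le_of_lt
      (Finset.single_le_sum (f := F ω) (fun d _ => hF0 ω d) (Finset.mem_Icc.mpr ⟨h1, h2⟩)) hlt
    simp only [F, dif_pos hd] at hFd
    have p1 : 0 ≤ A ^ d * ∑ c ∈ Cset (n - k) n (seq H1 ω) d hd, t ^ wt c := by positivity
    have p2 : 0 ≤ ∑ c ∈ Cset (n - k) n (seq H1 ω) d hd, s ^ wt c := by positivity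
    constructor
    · intro cw hcw
      by_contra hw
      rw [not_le] at hw
      have g1 : t ^ wt cw ≤ ∑ c ∈ Cset (n - k) n (seq H1 ω) d hd, t ^ wt c :=
        Finset.single_le_sum (f := fun c => t ^ wt c) (fun c _ => by positivity) hcw
      have g2 : A ^ d = t ^ (-(α * n * d)) := by
        rw [hA, ← Real.rpow_natCast, ← Real.rpow_natCast, ← Real.rpow_mul ht0.le,
          ← Real.rpow_mul ht0.le]
        congr 1; ring
      have g3 : 1 ≤ A ^ d * t ^ wt cw := by
        rw [g2, ← Real.rpow_natCast, ← Real.rpow_add ht0]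
        exact Real.one_le_rpow_of_pos_of_le_one_of_nonpos ht0 ht1 (by linarith)
      have g4 := mul_le_mul_of_nonneg_left g1 (pow_pos hA0 d).le
      linarith
    · intro w _
      have g1 : (numW (n - k) n (seq H1 ω) d hd w : ℝ) * s ^ w ≤
          ∑ c ∈ Cset (n - k) n (seq H1 ω) d hd, s ^ wt c := by
        refine le_trans (le_of_eq ?_) (Finset.sum_le_sum_of_subset_of_nonneg
          (Finset.filter_subset (fun c => wt c = w) _) (fun c _ _ => by positivity))
        rw [Finset.sum_congr rfl (g := fun _ => s ^ w)
          (fun c hc => by rw [(Finset.mem_filter.mp hc).2])]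
        rw [Finset.sum_const, nsmul_eq_mul, numW]
      have g2 : s ^ w = ((2:ℝ) ^ (θ * w))⁻¹ := by
        rw [hs, ← Real.rpow_natCast, ← Real.rpow_mul (by norm_num), ← Real.rpow_neg (by norm_num)]
        congr 1; ring
      rw [g2, ← div_eq_mul_inv, div_le_iff₀ (by positivity)] at g1
      refine g1.trans ?_
      have : (0:ℝ) < 2 ^ (θ * w) := by positivity
      nlinarith
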